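/- arXiv:math/0403049 — 4 statements merged into one kernel-verified Lean document; each statement's English description precedes it below -/
import Mathlib

section
/- Dunkl transform of the exponential kernel (Poisson kernel formula): for every κ > 0 and every y ∈ ℝ, c_κ ∫_ℝ e^{−|x|} E(x, −iy) dμ_κ(x) = (2^{κ+1/2} Γ(κ+1) / √π) · (1 + y²)^{−(κ+1)}. -/
open MeasureTheory Real Filter Topology

/-- The weighted measure `dμ_κ(t) = |t|^{2κ} dt` on `ℝ`. -/
noncomputable def mu (κ : ℝ) : Measure ℝ :=
  MeasureTheory.volume.withDensity (fun t => ENNReal.ofReal (|t| ^ (2 * κ)))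

/-- The normalizing constant `b_κ = Γ(κ+1/2)/(√π Γ(κ))`. -/
noncomputable def bk (κ : ℝ) : ℝ := Real.Gamma (κ + 1 / 2) / (Real.sqrt π * Real.Gamma κ)

/-- The one-dimensional Dunkl kernel `E(z,w)` for the reflection group `ℤ₂`. -/
noncomputable def Ek (κ : ℝ) (z w : ℂ) : ℂ :=
  (bk κ : ℂ) * ∫ u in Set.Ioo (-1 : ℝ) 1,
    Complex.exp (z * w * (u : ℂ)) * (((1 + u) * (1 - u ^ 2) ^ (κ - 1) : ℝ) : ℂ)

/-- The constant `c_κ` with `c_κ⁻¹ = ∫ e^{-x²/2} dμ_κ(x)`. -/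
noncomputable def ck (κ : ℝ) : ℝ := (∫ x, Real.exp (-x ^ 2 / 2) ∂(mu κ))⁻¹

/-- The Dunkl transform `f̂(y) = c_κ ∫ f(x) E(x,-iy) dμ_κ(x)`. -/
noncomputable def dunkl (κ : ℝ) (f : ℝ → ℂ) (y : ℝ) : ℂ :=
  (ck κ : ℂ) * ∫ x, f x * Ek κ (x : ℂ) (-Complex.I * (y : ℂ)) ∂(mu κ)

open Set

theorem integrableOn_rpow_mul_exp_neg_mul_cexp {a : ℝ} (ha : 0 < a) (s : ℝ) :
    IntegrableOn (fun x : ℝ => ((x ^ (a - 1) * rexp (-x) : ℝ) : ℂ) *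
      Complex.exp (-(s * x * Complex.I))) (Ioi 0) := by
  have h : IntegrableOn (fun x : ℝ => ((x ^ (a - 1) * rexp (-x) : ℝ) : ℂ)) (Ioi 0) := by
    have h' : IntegrableOn (fun x : ℝ => x ^ (a - 1) * rexp (-x)) (Ioi 0) := by
      simpa only [mul_comm] using Real.GammaIntegral_convergent ha
    exact h'.ofReal
  refine Integrable.mul_bdd (c := 1) h (by fun_prop) (ae_of_all _ fun x => ?_)
  rw [Complex.norm_exp]
  simp

theorem hasDerivAt_integral_rpow_mul_exp_neg_mul_cexp {a : ℝ} (ha : 0 < a) (s : ℝ) :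
    HasDerivAt (fun s : ℝ => ∫ x in Ioi (0 : ℝ), ((x ^ (a - 1) * rexp (-x) : ℝ) : ℂ) *
      Complex.exp (-(s * x * Complex.I)))
      (-Complex.I * ∫ x in Ioi (0 : ℝ), ((x ^ (a + 1 - 1) * rexp (-x) : ℝ) : ℂ) *
        Complex.exp (-(s * x * Complex.I))) s := by
  rw [← integral_const_mul]
  have hb : IntegrableOn (fun x : ℝ => x ^ (a + 1 - 1) * rexp (-x)) (Ioi 0) := by
    simpa only [mul_comm] using Real.GammaIntegral_convergent (by positivity : 0 < a + 1)
  refine (hasDerivAt_integral_of_dominated_loc_of_deriv_le (s := univ)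
    (F' := fun (t x : ℝ) => -Complex.I * (((x ^ (a + 1 - 1) * rexp (-x) : ℝ) : ℂ) *
      Complex.exp (-(t * x * Complex.I)))) Filter.univ_mem
    (Eventually.of_forall fun t =>
      (integrableOn_rpow_mul_exp_neg_mul_cexp ha t).aestronglyMeasurable)
    (integrableOn_rpow_mul_exp_neg_mul_cexp ha s)
    ((integrableOn_rpow_mul_exp_neg_mul_cexp (by positivity : 0 < a + 1) s).const_mul
      _).aestronglyMeasurable
    ?_ hb ?_).2
  · refine (ae_restrict_iff' measurableSet_Ioi).2 (ae_of_all _ fun x hx t _ => ?_)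
    have hx : 0 < x := hx
    rw [norm_mul, norm_mul, Complex.norm_exp, Complex.norm_real,
      Real.norm_of_nonneg (by positivity)]
    simp
  · refine (ae_restrict_iff' measurableSet_Ioi).2 (ae_of_all _ fun x hx t _ => ?_)
    have hx : 0 < x := hx
    have h1 : HasDerivAt (fun t : ℝ => -((t : ℂ) * x * Complex.I)) (-(1 * x * Complex.I)) t :=
      (((hasDerivAt_id t).ofReal_comp.mul_const (x : ℂ)).mul_const Complex.I).neg
    refine (h1.cexp.const_mul _).congr_deriv ?_
    rw [show a + 1 - 1 = (a - 1) + 1 by ring, Real.rpow_add_one hx.ne']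
    push_cast
    ring

theorem integral_rpow_mul_exp_neg_mul_cexp_succ {a : ℝ} (ha : 0 < a) (s : ℝ) :
    (1 + s * Complex.I) * ∫ x in Ioi (0 : ℝ), ((x ^ (a + 1 - 1) * rexp (-x) : ℝ) : ℂ) *
        Complex.exp (-(s * x * Complex.I)) =
    a * ∫ x in Ioi (0 : ℝ), ((x ^ (a - 1) * rexp (-x) : ℝ) : ℂ) *
        Complex.exp (-(s * x * Complex.I)) := by
  have i0 := (integrableOn_rpow_mul_exp_neg_mul_cexp ha s).const_mul (a : ℂ)
  have i1 := (integrableOn_rpow_mul_exp_neg_mul_cexp (by positivity : 0 < a + 1) s).const_mul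
    (1 + s * Complex.I)
  have key := integral_Ioi_of_hasDerivAt_of_tendsto (a := 0) (m := 0)
    (f := fun x : ℝ => ((x ^ a * rexp (-x) : ℝ) : ℂ) * Complex.exp (-(s * x * Complex.I)))
    ?_ ?_ (i0.sub i1) ?_
  · rw [integral_sub' i0 i1, integral_const_mul, integral_const_mul] at key
    simp only [Real.zero_rpow ha.ne', zero_mul, Complex.ofReal_zero, sub_zero] at key
    exact (sub_eq_zero.1 key).symm
  · refine ContinuousAt.continuousWithinAt ?_
    have : ContinuousAt (fun x : ℝ => x ^ a) 0 := Real.continuousAt_rpow_const _ _ (Or.inr ha.le)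
    fun_prop
  · intro x hx
    have hx : 0 < x := hx
    have h1 : HasDerivAt (fun t : ℝ => -((s : ℂ) * t * Complex.I)) (-(s * 1 * Complex.I)) x :=
      (((hasDerivAt_id x).ofReal_comp.const_mul (s : ℂ)).mul_const Complex.I).neg
    have h2 := ((Real.hasDerivAt_rpow_const (p := a) (Or.inl hx.ne')).mul
      (hasDerivAt_neg x).exp).ofReal_comp
    refine (h2.mul h1.cexp).congr_deriv ?_
    rw [show a + 1 - 1 = a by ring]
    simp only [Pi.mul_apply, Pi.sub_apply]
    push_cast
    ring
  · rw [tendsto_zero_iff_norm_tendsto_zero]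
    have := (isLittleO_exp_neg_mul_rpow_atTop one_pos (-a)).tendsto_div_nhds_zero
    refine this.congr' ?_
    filter_upwards [eventually_gt_atTop 0] with x hx
    rw [norm_mul, Complex.norm_exp, Complex.norm_real, Real.norm_of_nonneg (by positivity),
      Real.rpow_neg hx.le]
    simp [mul_comm]

theorem one_add_mul_I_mem_slitPlane (s : ℝ) : 1 + s * Complex.I ∈ Complex.slitPlane :=
  Or.inl (by simp)

theorem hasDerivAt_one_add_mul_I_cpow (c : ℂ) (s : ℝ) :
    HasDerivAt (fun s : ℝ => (1 + s * Complex.I) ^ c)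
      (c * (1 + s * Complex.I) ^ (c - 1) * Complex.I) s := by
  have h : HasDerivAt (fun s : ℝ => 1 + (s : ℂ) * Complex.I) (1 * Complex.I) s :=
    ((hasDerivAt_id s).ofReal_comp.mul_const Complex.I).const_add 1
  rw [one_mul] at h
  exact HasDerivAt.comp_of_eq s
    (Complex.hasStrictDerivAt_cpow_const (one_add_mul_I_mem_slitPlane s)).hasDerivAt h rfl

/-- The Fourier transform of the Gamma density. -/
theorem integral_rpow_mul_exp_neg_mul_cexp {a : ℝ} (ha : 0 < a) (s : ℝ) :
    ∫ x in Ioi (0 : ℝ), ((x ^ (a - 1) * rexp (-x) : ℝ) : ℂ) *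
        Complex.exp (-(s * x * Complex.I)) =
      Real.Gamma a * (1 + s * Complex.I) ^ (-a : ℂ) := by
  set φ : ℝ → ℂ := fun s => ∫ x in Ioi (0 : ℝ), ((x ^ (a - 1) * rexp (-x) : ℝ) : ℂ) *
        Complex.exp (-(s * x * Complex.I)) with hφ
  have hd : ∀ t : ℝ, HasDerivAt (fun t : ℝ => φ t * (1 + t * Complex.I) ^ (a : ℂ)) 0 t := by
    intro t
    have hne := Complex.slitPlane_ne_zero (one_add_mul_I_mem_slitPlane t)
    have h₁ : HasDerivAt φ _ t := hasDerivAt_integral_rpow_mul_exp_neg_mul_cexp ha t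
    have h₂ : _ = a * φ t := integral_rpow_mul_exp_neg_mul_cexp_succ ha t
    generalize (∫ x in Ioi (0 : ℝ), ((x ^ (a + 1 - 1) * rexp (-x) : ℝ) : ℂ) *
        Complex.exp (-(t * x * Complex.I))) = ψ at h₁ h₂
    refine (h₁.mul (hasDerivAt_one_add_mul_I_cpow a t)).congr_deriv ?_
    rw [Complex.cpow_sub _ _ hne, Complex.cpow_one]
    generalize (1 + t * Complex.I) ^ (a : ℂ) = q
    generalize 1 + t * Complex.I = z at hne h₂ ⊢
    field_simp
    linear_combination (-Complex.I * q) * h₂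
  have hc := is_const_of_deriv_eq_zero (fun t => (hd t).differentiableAt)
    (fun t => (hd t).deriv) s 0
  have h0 : φ 0 = Real.Gamma a := by
    simp only [hφ, Complex.ofReal_zero, zero_mul, neg_zero, Complex.exp_zero, mul_one]
    rw [integral_complex_ofReal, Real.Gamma_eq_integral ha]
    simp only [mul_comm]
  have hne := Complex.slitPlane_ne_zero (one_add_mul_I_mem_slitPlane s)
  change φ s = _
  simp only [h0, Complex.ofReal_zero, zero_mul, add_zero, Complex.one_cpow, mul_one] at hc
  rw [← hc, mul_assoc, ← Complex.cpow_add _ _ hne, add_neg_cancel, Complex.cpow_zero, mul_one]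

theorem one_sub_sq_rpow_comp_affine {κ x : ℝ} (hx : x ∈ Ioo (0 : ℝ) 1) :
    ((1 - (2 * x + -1) ^ 2 : ℝ) ^ (κ - 1) : ℝ) =
      ((4 : ℝ) ^ (κ - 1) : ℝ) * ((x : ℂ) ^ ((κ : ℂ) - 1) * (1 - (x : ℂ)) ^ ((κ : ℂ) - 1)) := by
  have h0 : 0 ≤ x := hx.1.le
  have h1 : 0 ≤ 1 - x := by linarith [hx.2]
  rw [show 1 - (2 * x + -1) ^ 2 = 4 * (x * (1 - x)) by ring, Real.mul_rpow (by norm_num)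
    (mul_nonneg h0 h1), Real.mul_rpow h0 h1]
  push_cast [Complex.ofReal_cpow h0, Complex.ofReal_cpow h1]
  rfl

theorem intervalIntegrable_one_sub_sq_rpow {κ : ℝ} (hκ : 0 < κ) :
    IntervalIntegrable (fun u : ℝ => (((1 - u ^ 2) ^ (κ - 1) : ℝ) : ℂ)) volume (-1) 1 := by
  have h := (Complex.betaIntegral_convergent (u := κ) (v := κ) (by simpa) (by simpa)).const_mul
    (((4 : ℝ) ^ (κ - 1) : ℝ) : ℂ)
  have h' : IntervalIntegrable
      (fun x : ℝ => (((1 - (2 * x + -1) ^ 2 : ℝ) ^ (κ - 1) : ℝ) : ℂ)) volume 0 1 := by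
    rw [intervalIntegrable_iff_integrableOn_Ioo_of_le zero_le_one] at h ⊢
    exact h.congr_fun (fun x hx => (one_sub_sq_rpow_comp_affine hx).symm) measurableSet_Ioo
  have h2 := (h'.comp_mul_left (c := 1 / 2)).comp_add_right 1
  norm_num at h2
  convert! h2 using 4
  ring_nf

theorem integral_one_sub_sq_rpow {κ : ℝ} (hκ : 0 < κ) :
    (bk κ : ℂ) * ∫ u in (-1 : ℝ)..1, (((1 - u ^ 2) ^ (κ - 1) : ℝ) : ℂ) = 1 := by
  have h := intervalIntegral.smul_integral_comp_mul_add (a := 0) (b := 1)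
    (fun u : ℝ => (((1 - u ^ 2) ^ (κ - 1) : ℝ) : ℂ)) 2 (-1)
  have h2 : ∫ x in (0 : ℝ)..1, (((1 - (2 * x + -1) ^ 2 : ℝ) ^ (κ - 1) : ℝ) : ℂ) =
      (((4 : ℝ) ^ (κ - 1) : ℝ) : ℂ) * Complex.betaIntegral κ κ := by
    rw [Complex.betaIntegral, ← intervalIntegral.integral_const_mul,
      intervalIntegral.integral_of_le zero_le_one, intervalIntegral.integral_of_le zero_le_one,
      integral_Ioc_eq_integral_Ioo, integral_Ioc_eq_integral_Ioo]
    exact setIntegral_congr_fun measurableSet_Ioo (fun x hx => one_sub_sq_rpow_comp_affine hx)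
  rw [h2, Complex.betaIntegral_eq_Gamma_mul_div _ _ (by simpa) (by simpa)] at h
  norm_num at h
  have d := Real.Gamma_mul_Gamma_add_half κ
  have g1 := Real.Gamma_pos_of_pos hκ
  have g2 := Real.Gamma_pos_of_pos (by positivity : 0 < κ + κ)
  have g3 : 0 < √π := by positivity
  have e : (2 : ℝ) * (4 : ℝ) ^ (κ - 1) * 2 ^ (1 - 2 * κ) = 1 := by
    rw [show (4 : ℝ) = 2 ^ (2 : ℝ) by norm_num, ← Real.rpow_mul (by norm_num)]
    nth_rw 1 [← Real.rpow_one 2]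
    rw [← Real.rpow_add two_pos, ← Real.rpow_add two_pos]
    ring_nf
    simp
  have key : bk κ * (2 * ((4 : ℝ) ^ (κ - 1) *
      (Real.Gamma κ * Real.Gamma κ / Real.Gamma (κ + κ)))) = 1 := by
    rw [bk]
    rw [two_mul κ] at d e
    generalize Real.Gamma κ = G at *
    generalize Real.Gamma (κ + κ) = H at *
    generalize Real.Gamma (κ + 1 / 2) = K at *
    field_simp
    linear_combination 2 * (4 : ℝ) ^ (κ - 1) * d + √π * H * e
  rw [← h, ← Complex.ofReal_add, Complex.Gamma_ofReal, Complex.Gamma_ofReal]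
  have key' := congrArg Complex.ofReal key
  push_cast at key' ⊢
  exact key'

theorem norm_one_add_mul_I_cpow_neg_le_one {c : ℝ} (hc : 0 ≤ c) (s : ℝ) :
    ‖(1 + s * Complex.I) ^ (-c : ℂ)‖ ≤ 1 := by
  rw [← Complex.ofReal_neg, Complex.norm_cpow_real]
  refine Real.rpow_le_one_of_one_le_of_nonpos ?_ (by linarith)
  simpa using Complex.abs_re_le_norm (1 + s * Complex.I)

theorem continuous_one_add_mul_I_cpow (c : ℂ) :
    Continuous (fun s : ℝ => (1 + s * Complex.I) ^ c) :=
  continuous_iff_continuousAt.2 fun s => (hasDerivAt_one_add_mul_I_cpow c s).continuousAt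

theorem hasDerivAt_integral_one_sub_sq_mul_cpow {κ : ℝ} (hκ : 0 < κ) (y : ℝ) :
    HasDerivAt (fun y : ℝ => ∫ u in (-1 : ℝ)..1, (((1 - u ^ 2) ^ (κ - 1) : ℝ) : ℂ) *
        (1 + (y * u : ℝ) * Complex.I) ^ (-(2 * κ + 1 : ℝ) : ℂ))
      (∫ u in (-1 : ℝ)..1, (((1 - u ^ 2) ^ (κ - 1) : ℝ) : ℂ) *
        ((1 + (y * u : ℝ) * Complex.I) ^ (-(2 * κ + 2 : ℝ) : ℂ) *
          (-(2 * κ + 1) * Complex.I * u))) y := by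
  have hw := intervalIntegrable_one_sub_sq_rpow hκ
  have hb := hw.norm.const_mul (2 * κ + 1)
  have hc : ∀ (c : ℂ) (t : ℝ), Continuous fun u : ℝ => (1 + (t * u : ℝ) * Complex.I) ^ c :=
    fun c t => (continuous_one_add_mul_I_cpow c).comp (continuous_const.mul continuous_id)
  refine (intervalIntegral.hasDerivAt_integral_of_dominated_loc_of_deriv_le (s := univ)
    (F' := fun (y u : ℝ) => (((1 - u ^ 2) ^ (κ - 1) : ℝ) : ℂ) *
        ((1 + (y * u : ℝ) * Complex.I) ^ (-(2 * κ + 2 : ℝ) : ℂ) *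
          (-(2 * κ + 1) * Complex.I * u))) Filter.univ_mem
    (Eventually.of_forall fun t => ?_) (hw.mul_continuousOn (hc _ y).continuousOn) ?_ ?_ hb ?_).2
  · exact (hw.mul_continuousOn (hc _ t).continuousOn).def'.aestronglyMeasurable
  · refine (hw.mul_continuousOn (Continuous.continuousOn ?_)).def'.aestronglyMeasurable
    have := hc (-(2 * κ + 2 : ℝ) : ℂ) y
    fun_prop
  · refine ae_of_all _ fun u hu t _ => ?_
    rw [uIoc_of_le (by norm_num)] at hu
    have h1 := norm_one_add_mul_I_cpow_neg_le_one (by positivity : 0 ≤ 2 * κ + 2) (t * u)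
    have h2 : ‖(-(2 * κ + 1) * Complex.I * u : ℂ)‖ ≤ 2 * κ + 1 := by
      have : ‖(2 * κ + 1 : ℂ)‖ = 2 * κ + 1 := by
        rw [show (2 * κ + 1 : ℂ) = ((2 * κ + 1 : ℝ) : ℂ) by push_cast; rfl, Complex.norm_real,
          Real.norm_of_nonneg (by positivity)]
      rw [norm_mul, norm_mul, norm_neg, this, Complex.norm_I, Complex.norm_real, mul_one]
      exact mul_le_of_le_one_right (by positivity) (abs_le.2 ⟨hu.1.le, hu.2⟩)
    rw [norm_mul, norm_mul, mul_comm]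
    refine mul_le_mul_of_nonneg_right ?_ (norm_nonneg _)
    calc _ ≤ 1 * (2 * κ + 1) := mul_le_mul h1 h2 (norm_nonneg _) zero_le_one
      _ = _ := one_mul _
  · refine ae_of_all _ fun u _ t _ => ?_
    have h := (hasDerivAt_one_add_mul_I_cpow (-(2 * κ + 1 : ℝ) : ℂ) (t * u)).scomp t
      ((hasDerivAt_id t).mul_const u)
    refine (h.const_mul _).congr_deriv ?_
    rw [show (-(2 * κ + 1 : ℝ) - 1 : ℂ) = -(2 * κ + 2 : ℝ) by push_cast; ring]
    simp only [one_mul, Complex.real_smul]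
    push_cast
    ring

theorem integral_one_sub_sq_mul_cpow_relation {κ : ℝ} (hκ : 0 < κ) (y : ℝ) :
    (1 + y ^ 2) * (∫ u in (-1 : ℝ)..1, (((1 - u ^ 2) ^ (κ - 1) : ℝ) : ℂ) *
        ((1 + (y * u : ℝ) * Complex.I) ^ (-(2 * κ + 2 : ℝ) : ℂ) *
          (-(2 * κ + 1) * Complex.I * u))) +
      2 * (κ + 1) * y * ∫ u in (-1 : ℝ)..1, (((1 - u ^ 2) ^ (κ - 1) : ℝ) : ℂ) *
        (1 + (y * u : ℝ) * Complex.I) ^ (-(2 * κ + 1 : ℝ) : ℂ) = 0 := by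
  have hw := intervalIntegrable_one_sub_sq_rpow hκ
  have hc : ∀ (c : ℂ), Continuous fun u : ℝ => (1 + (y * u : ℝ) * Complex.I) ^ c :=
    fun c => (continuous_one_add_mul_I_cpow c).comp (continuous_const.mul continuous_id)
  have c1 := hc (-(2 * κ + 1 : ℝ) : ℂ)
  have c2 := hc (-(2 * κ + 2 : ℝ) : ℂ)
  have i1 : IntervalIntegrable (fun u : ℝ => (((1 - u ^ 2) ^ (κ - 1) : ℝ) : ℂ) *
      ((1 + (y * u : ℝ) * Complex.I) ^ (-(2 * κ + 2 : ℝ) : ℂ) *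
          (-(2 * κ + 1) * Complex.I * u))) volume (-1) 1 :=
    hw.mul_continuousOn (Continuous.continuousOn (by fun_prop))
  have i2 : IntervalIntegrable (fun u : ℝ => (((1 - u ^ 2) ^ (κ - 1) : ℝ) : ℂ) *
      (1 + (y * u : ℝ) * Complex.I) ^ (-(2 * κ + 1 : ℝ) : ℂ)) volume (-1) 1 :=
    hw.mul_continuousOn c1.continuousOn
  rw [← intervalIntegral.integral_const_mul, ← intervalIntegral.integral_const_mul,
    ← intervalIntegral.integral_add (i1.const_mul _) (i2.const_mul _)]
  rw [intervalIntegral.integral_eq_sub_of_hasDerivAt_of_le (by norm_num)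
    (f := fun u : ℝ => (((1 - u ^ 2) ^ κ : ℝ) : ℂ) * (Complex.I *
      ((1 + (y * u : ℝ) * Complex.I) ^ (-(2 * κ + 1 : ℝ) : ℂ) *
        (1 + (1 + (y * u : ℝ) * Complex.I) / (2 * κ))))) ?_ ?_
        ((i1.const_mul _).add (i2.const_mul _))]
  · simp [Real.zero_rpow hκ.ne']
  · refine Continuous.continuousOn (Continuous.mul ?_ (by fun_prop))
    exact Complex.continuous_ofReal.comp
      ((continuous_const.sub (continuous_pow 2)).rpow_const fun _ => Or.inr hκ.le)
  · intro u hu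
    have hu1 : 0 < 1 - u ^ 2 := by nlinarith [hu.1, hu.2]
    have hne := Complex.slitPlane_ne_zero (one_add_mul_I_mem_slitPlane (y * u))
    have hl : HasDerivAt (fun u : ℝ => y * u) y u := by
      simpa using (hasDerivAt_id u).const_mul y
    have hq := (hasDerivAt_one_add_mul_I_cpow (-(2 * κ + 1 : ℝ) : ℂ) (y * u)).scomp u hl
    have hz : HasDerivAt (fun u : ℝ => 1 + (1 + (y * u : ℝ) * Complex.I) / (2 * κ))
        ((y * Complex.I) / (2 * κ)) u :=
      (((hl.ofReal_comp.mul_const Complex.I).const_add 1).div_const _).const_add 1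
    have hp : HasDerivAt (fun u : ℝ => (1 - u ^ 2) ^ κ) _ u :=
      ((hasDerivAt_pow 2 u).const_sub 1).rpow_const (p := κ) (Or.inl hu1.ne')
    refine (hp.ofReal_comp.mul ((hq.mul hz).const_mul Complex.I)).congr_deriv ?_
    have e1 : (1 - u ^ 2) ^ κ = (1 - u ^ 2) ^ (κ - 1) * (1 - u ^ 2) := by
      rw [← Real.rpow_add_one hu1.ne', sub_add_cancel]
    have e2 : (1 + (y * u : ℝ) * Complex.I) ^ (-(2 * κ + 1 : ℝ) : ℂ) =
        (1 + (y * u : ℝ) * Complex.I) ^ (-(2 * κ + 2 : ℝ) : ℂ) *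
          (1 + (y * u : ℝ) * Complex.I) := by
      nth_rw 3 [← Complex.cpow_one (1 + (y * u : ℝ) * Complex.I)]
      rw [← Complex.cpow_add _ _ hne]
      congr 1
      push_cast
      ring
    simp only [Pi.mul_apply, Function.comp_apply, Complex.real_smul]
    rw [show (-(2 * κ + 1 : ℝ) - 1 : ℂ) = -(2 * κ + 2 : ℝ) by push_cast; ring, e2, e1]
    generalize (1 + (y * u : ℝ) * Complex.I) ^ (-(2 * κ + 2 : ℝ) : ℂ) = P
    generalize (1 - u ^ 2) ^ (κ - 1) = W
    have hκ' : (κ : ℂ) ≠ 0 := by exact_mod_cast hκ.ne'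
    push_cast
    field_simp
    ring_nf
    simp only [Complex.I_sq, Complex.I_pow_three]
    ring

theorem integral_one_sub_sq_mul_cpow {κ : ℝ} (hκ : 0 < κ) (y : ℝ) :
    ∫ u in (-1 : ℝ)..1, (((1 - u ^ 2) ^ (κ - 1) : ℝ) : ℂ) *
        (1 + (y * u : ℝ) * Complex.I) ^ (-(2 * κ + 1 : ℝ) : ℂ) =
    (((1 + y ^ 2) ^ (-(κ + 1)) : ℝ) : ℂ) *
      ∫ u in (-1 : ℝ)..1, (((1 - u ^ 2) ^ (κ - 1) : ℝ) : ℂ) := by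
  set F : ℝ → ℂ := fun y => ∫ u in (-1 : ℝ)..1, (((1 - u ^ 2) ^ (κ - 1) : ℝ) : ℂ) *
        (1 + (y * u : ℝ) * Complex.I) ^ (-(2 * κ + 1 : ℝ) : ℂ) with hF
  have hd : ∀ t : ℝ, HasDerivAt (fun t : ℝ => F t * (((1 + t ^ 2) ^ (κ + 1) : ℝ) : ℂ)) 0 t := by
    intro t
    have hpos : 0 < 1 + t ^ 2 := by positivity
    have h₁ : HasDerivAt F _ t := hasDerivAt_integral_one_sub_sq_mul_cpow hκ t
    have h₂ : _ + _ * F t = 0 := integral_one_sub_sq_mul_cpow_relation hκ t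
    generalize (∫ u in (-1 : ℝ)..1, (((1 - u ^ 2) ^ (κ - 1) : ℝ) : ℂ) *
        ((1 + (t * u : ℝ) * Complex.I) ^ (-(2 * κ + 2 : ℝ) : ℂ) *
          (-(2 * κ + 1) * Complex.I * u))) = ψ at h₁ h₂
    have hp : HasDerivAt (fun u : ℝ => (1 + u ^ 2) ^ (κ + 1)) _ t :=
      ((hasDerivAt_pow 2 t).const_add 1).rpow_const (Or.inl hpos.ne')
    refine (h₁.mul hp.ofReal_comp).congr_deriv ?_
    rw [Real.rpow_add_one hpos.ne', add_sub_cancel_right]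
    push_cast
    linear_combination (((1 + t ^ 2) ^ κ : ℝ) : ℂ) * h₂
  have hc := is_const_of_deriv_eq_zero (fun t => (hd t).differentiableAt)
    (fun t => (hd t).deriv) y 0
  have h0 : F 0 = ∫ u in (-1 : ℝ)..1, (((1 - u ^ 2) ^ (κ - 1) : ℝ) : ℂ) := by
    simp [hF]
  change F y = _
  simp only [h0] at hc
  norm_num at hc
  have hpos : 0 < 1 + y ^ 2 := by positivity
  rw [← hc, mul_comm, mul_assoc, ← Complex.ofReal_mul, ← Real.rpow_add hpos]
  simp

theorem integrableOn_Iic_of_comp_neg {E : Type*} [NormedAddCommGroup E] {f : ℝ → E}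
    (hf : IntegrableOn (fun x => f (-x)) (Ioi 0)) : IntegrableOn f (Iic 0) := by
  rw [integrableOn_Iic_iff_integrableOn_Iio]
  have := (Measure.measurePreserving_neg (volume : Measure ℝ)).integrableOn_comp_preimage
    (Homeomorph.neg ℝ).measurableEmbedding (f := f) (s := Iio 0)
  rw [← this]
  simpa [Function.comp_def] using hf

theorem integrable_abs_rpow_mul_exp_neg_abs_mul_cexp {κ : ℝ} (hκ : 0 < κ) (s : ℝ) :
    Integrable (fun x : ℝ => ((|x| ^ (2 * κ) * rexp (-|x|) : ℝ) : ℂ) *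
      Complex.exp (-(s * x * Complex.I))) := by
  have h : ∀ s : ℝ, IntegrableOn (fun x : ℝ => ((|x| ^ (2 * κ) * rexp (-|x|) : ℝ) : ℂ) *
      Complex.exp (-(s * x * Complex.I))) (Ioi 0) := fun s => by
    refine (integrableOn_rpow_mul_exp_neg_mul_cexp (by positivity : 0 < 2 * κ + 1) s).congr_fun
      (fun x hx => ?_) measurableSet_Ioi
    simp only [add_sub_cancel_right, abs_of_pos (show 0 < x from hx)]
  rw [← integrableOn_univ, ← Iic_union_Ioi (a := (0 : ℝ))]
  refine (integrableOn_Iic_of_comp_neg ?_).union (h s)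
  simpa using h (-s)

theorem integral_abs_rpow_mul_exp_neg_abs_mul_cexp {κ : ℝ} (hκ : 0 < κ) (s : ℝ) :
    ∫ x : ℝ, ((|x| ^ (2 * κ) * rexp (-|x|) : ℝ) : ℂ) * Complex.exp (-(s * x * Complex.I)) =
      Real.Gamma (2 * κ + 1) * ((1 + s * Complex.I) ^ (-(2 * κ + 1 : ℝ) : ℂ) +
        (1 + (-s : ℝ) * Complex.I) ^ (-(2 * κ + 1 : ℝ) : ℂ)) := by
  have hi := integrable_abs_rpow_mul_exp_neg_abs_mul_cexp hκ s
  have h : ∀ s : ℝ, ∫ x in Ioi (0 : ℝ), ((|x| ^ (2 * κ) * rexp (-|x|) : ℝ) : ℂ) *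
      Complex.exp (-(s * x * Complex.I)) =
      Real.Gamma (2 * κ + 1) * (1 + s * Complex.I) ^ (-(2 * κ + 1 : ℝ) : ℂ) := fun s => by
    rw [← integral_rpow_mul_exp_neg_mul_cexp (by positivity : 0 < 2 * κ + 1) s]
    refine setIntegral_congr_fun measurableSet_Ioi (fun x hx => ?_)
    simp only [add_sub_cancel_right, abs_of_pos (show 0 < x from hx)]
  have h' := h (-s)
  have hn := integral_comp_neg_Ioi 0 (fun x : ℝ => ((|x| ^ (2 * κ) * rexp (-|x|) : ℝ) : ℂ) *
    Complex.exp (-(s * x * Complex.I)))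
  rw [← setIntegral_univ, ← Iic_union_Ioi (a := (0 : ℝ)),
    setIntegral_union (Iic_disjoint_Ioi le_rfl) measurableSet_Ioi hi.integrableOn
      hi.integrableOn, h s, mul_add, add_comm]
  congr 1
  rw [← h', ← neg_zero, ← hn]
  simp

theorem integral_mu {E : Type*} [NormedAddCommGroup E] [NormedSpace ℝ E] (κ : ℝ) (g : ℝ → E) :
    ∫ x, g x ∂(mu κ) = ∫ x : ℝ, |x| ^ (2 * κ) • g x := by
  rw [mu, integral_withDensity_eq_integral_toReal_smul (by fun_prop) (by simp)]
  refine integral_congr_ae (ae_of_all _ fun x => ?_)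
  simp only [ENNReal.toReal_ofReal (Real.rpow_nonneg (abs_nonneg x) _)]

theorem ck_eq {κ : ℝ} (hκ : 0 < κ) :
    ck κ = (2 ^ (κ + 1 / 2) * Real.Gamma (κ + 1 / 2))⁻¹ := by
  rw [ck, integral_mu]
  have h := integral_comp_abs (f := fun x : ℝ => x ^ (2 * κ) * rexp (-(1 / 2) * x ^ (2 : ℝ)))
  rw [integral_rpow_mul_exp_neg_mul_rpow two_pos (by linarith) (by norm_num)] at h
  congr 1
  convert h using 1
  · refine integral_congr_ae (ae_of_all _ fun x => ?_)
    simp only [smul_eq_mul, Real.rpow_two, sq_abs]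
    ring_nf
  · rw [one_div, Real.inv_rpow two_pos.le, ← Real.rpow_neg two_pos.le,
      show -(-(2 * κ + 1) / 2) = κ + 2⁻¹ by ring, show (2 * κ + 1) / 2 = κ + 2⁻¹ by ring]
    ring

theorem integral_dunkl_weight_mul_symm {κ : ℝ} (hκ : 0 < κ) {g : ℝ → ℂ} (hg : Continuous g) :
    ∫ u in (-1 : ℝ)..1, (((1 + u) * (1 - u ^ 2) ^ (κ - 1) : ℝ) : ℂ) * (g u + g (-u)) =
      2 * ∫ u in (-1 : ℝ)..1, (((1 - u ^ 2) ^ (κ - 1) : ℝ) : ℂ) * g u := by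
  have hw := intervalIntegrable_one_sub_sq_rpow hκ
  have hi : ∀ {k : ℝ → ℂ}, Continuous k → IntervalIntegrable
      (fun u : ℝ => (((1 - u ^ 2) ^ (κ - 1) : ℝ) : ℂ) * k u) volume (-1) 1 :=
    fun hk => hw.mul_continuousOn hk.continuousOn
  have i1 := hi (k := fun u => (1 + u) * g u) (by fun_prop)
  have i2 := hi (k := fun u => (1 - u) * g u) (by fun_prop)
  have i3 := hi (k := fun u => (1 + u) * g (-u)) (by fun_prop)
  have hn := intervalIntegral.integral_comp_neg (a := -1) (b := 1)
    (fun u : ℝ => (((1 - u ^ 2) ^ (κ - 1) : ℝ) : ℂ) * ((1 - u) * g u))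
  simp only [even_two, Even.neg_pow, Complex.ofReal_neg, sub_neg_eq_add, neg_neg] at hn
  calc _ = ∫ u in (-1 : ℝ)..1, ((((1 - u ^ 2) ^ (κ - 1) : ℝ) : ℂ) * ((1 + u) * g u) +
        (((1 - u ^ 2) ^ (κ - 1) : ℝ) : ℂ) * ((1 + u) * g (-u))) := by
        congr 1
        ext u
        push_cast
        ring
    _ = ∫ u in (-1 : ℝ)..1, ((((1 - u ^ 2) ^ (κ - 1) : ℝ) : ℂ) * ((1 + u) * g u) +
        (((1 - u ^ 2) ^ (κ - 1) : ℝ) : ℂ) * ((1 - u) * g u)) := by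
        rw [intervalIntegral.integral_add i1 i3, hn, intervalIntegral.integral_add i1 i2]
    _ = _ := by
        rw [← intervalIntegral.integral_const_mul]
        congr 1
        ext u
        ring

theorem integral_exp_neg_abs_mul_Ek {κ : ℝ} (hκ : 0 < κ) (y : ℝ) :
    ∫ x, ((Real.exp (-|x|) : ℝ) : ℂ) * Ek κ (x : ℂ) (-Complex.I * (y : ℂ)) ∂(mu κ) =
      2 * Real.Gamma (2 * κ + 1) * (((1 + y ^ 2) ^ (-(κ + 1)) : ℝ) : ℂ) := by
  set ν := (volume : Measure ℝ).restrict (Ioo (-1) 1) with hν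
  set f : ℝ → ℂ := fun x => ((|x| ^ (2 * κ) * rexp (-|x|) : ℝ) : ℂ) with hf
  set w : ℝ → ℂ := fun u => (((1 + u) * (1 - u ^ 2) ^ (κ - 1) : ℝ) : ℂ) with hw
  have hfi : Integrable f := by simpa [hf] using integrable_abs_rpow_mul_exp_neg_abs_mul_cexp hκ 0
  have hwi : Integrable w ν := by
    have h := (intervalIntegrable_one_sub_sq_rpow hκ).mul_continuousOn
      (g := fun u : ℝ => (1 + u : ℂ)) (Continuous.continuousOn (by fun_prop))
    rw [intervalIntegrable_iff_integrableOn_Ioo_of_le (by norm_num)] at h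
    refine h.congr (ae_of_all _ fun u => ?_)
    simp only [hw]
    push_cast
    ring
  have hprod : Integrable (Function.uncurry fun x u : ℝ =>
      f x * w u * Complex.exp (-((y * u : ℝ) * x * Complex.I))) (volume.prod ν) := by
    refine (hfi.mul_prod hwi).mul_bdd (c := 1) (by fun_prop) (ae_of_all _ fun p => ?_)
    rw [Complex.norm_exp]
    simp
  have hswap := integral_integral_swap hprod
  have hg : Continuous fun u : ℝ => (1 + (y * u : ℝ) * Complex.I) ^ (-(2 * κ + 1 : ℝ) : ℂ) :=
    (continuous_one_add_mul_I_cpow _).comp (continuous_const.mul continuous_id)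
  have hR : ∀ u : ℝ, ∫ x, f x * w u * Complex.exp (-((y * u : ℝ) * x * Complex.I)) =
      Real.Gamma (2 * κ + 1) * (w u * ((1 + (y * u : ℝ) * Complex.I) ^ (-(2 * κ + 1 : ℝ) : ℂ) +
        (1 + (y * -u : ℝ) * Complex.I) ^ (-(2 * κ + 1 : ℝ) : ℂ))) := fun u => by
    have := integral_abs_rpow_mul_exp_neg_abs_mul_cexp hκ (y * u)
    simp only [mul_right_comm _ (w u)]
    rw [integral_mul_const, this, mul_neg]
    ring
  simp only [hR] at hswap
  rw [integral_const_mul, hν, ← integral_Ioc_eq_integral_Ioo,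
    ← intervalIntegral.integral_of_le (by norm_num), integral_dunkl_weight_mul_symm hκ hg,
    integral_one_sub_sq_mul_cpow hκ] at hswap
  have hb := integral_one_sub_sq_rpow hκ
  calc _ = ∫ x, (bk κ : ℂ) * ∫ u, f x * w u * Complex.exp (-((y * u : ℝ) * x * Complex.I)) ∂ν := by
        rw [integral_mu]
        refine integral_congr_ae (ae_of_all _ fun x => ?_)
        have hx : ∀ u : ℝ, f x * w u * Complex.exp (-((y * u : ℝ) * x * Complex.I)) =
            f x * (Complex.exp (x * (-Complex.I * y) * u) * w u) := fun u => by
          rw [mul_assoc, mul_comm (w u)]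
          congr 3
          push_cast
          ring
        simp only [hx, integral_const_mul]
        simp only [Ek, Complex.real_smul, hf, hw, hν]
        push_cast
        ring
    _ = _ := by
        rw [integral_const_mul, hν, hswap]
        linear_combination 2 * (Real.Gamma (2 * κ + 1) : ℂ) *
          (((1 + y ^ 2) ^ (-(κ + 1)) : ℝ) : ℂ) * hb

/-- the Dunkl transform of `e^{-|x|}` (Poisson kernel formula). -/
theorem dunkl_transform_exponential (κ : ℝ) (hκ : 0 < κ) (y : ℝ) :
    (ck κ : ℂ) * ∫ x, ((Real.exp (-|x|) : ℝ) : ℂ) *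
        Ek κ (x : ℂ) (-Complex.I * (y : ℂ)) ∂(mu κ) =
      (((2 : ℝ) ^ (κ + 1 / 2) * Real.Gamma (κ + 1) / Real.sqrt π *
        (1 + y ^ 2) ^ (-(κ + 1)) : ℝ) : ℂ) := by
  rw [integral_exp_neg_abs_mul_Ek hκ, ck_eq hκ]
  have d := Real.Gamma_mul_Gamma_add_half (κ + 1 / 2)
  rw [show κ + 1 / 2 + 1 / 2 = κ + 1 by ring, show 2 * (κ + 1 / 2) = 2 * κ + 1 by ring] at d
  have g1 := Real.Gamma_pos_of_pos (by positivity : 0 < κ + 1 / 2)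
  have g2 : 0 < √π := by positivity
  have e : (2 : ℝ) ^ (κ + 1 / 2) * 2 ^ (κ + 1 / 2) * 2 ^ (1 - (2 * κ + 1)) = 2 := by
    rw [← Real.rpow_add two_pos, ← Real.rpow_add two_pos]
    ring_nf
    simp
  have key : (2 ^ (κ + 1 / 2) * Real.Gamma (κ + 1 / 2))⁻¹ * (2 * Real.Gamma (2 * κ + 1)) =
      2 ^ (κ + 1 / 2) * Real.Gamma (κ + 1) / √π := by
    have p : (0 : ℝ) < 2 ^ (κ + 1 / 2) := by positivity
    generalize (2 : ℝ) ^ (κ + 1 / 2) = q at *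
    generalize Real.Gamma (κ + 1 / 2) = G at *
    field_simp
    linear_combination -q ^ 2 * d - Real.Gamma (2 * κ + 1) * √π * e
  rw [← key]
  push_cast
  ring
end

section
/- Paley–Wiener estimate (direct part): for every κ > 0 and B > 0, if f ∈ L¹(μ_κ) vanishes outside the interval [−B, B], then the function F : ℂ → ℂ defined by F(ζ) = c_κ ∫_ℝ f(x) E(x, −iζ) dμ_κ(x) is entire, agrees with the Dunkl transform f̂ on ℝ, and satisfies |F(ζ)| ≤ c_κ ‖f‖_{L¹(μ_κ)} e^{B |Im ζ|} for all ζ ∈ ℂ. -/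
open MeasureTheory Real Filter Topology

open ProbabilityTheory in
/-- The beta density has total mass one, as a Bochner integral. -/
lemma integrable_betaPDFReal_and_integral_eq_one {α β : ℝ} (hα : 0 < α) (hβ : 0 < β) :
    Integrable (betaPDFReal α β) ∧ ∫ x, betaPDFReal α β x = 1 := by
  have hnonneg : 0 ≤ᵐ[volume] betaPDFReal α β := .of_forall fun x => by
    by_cases hx : 0 < x ∧ x < 1
    · exact (betaPDFReal_pos hx.1 hx.2 hα hβ).le
    · simp [betaPDFReal, hx]
  have hmass : ∫⁻ x, ENNReal.ofReal (betaPDFReal α β x) = 1 := lintegral_betaPDF_eq_one hα hβ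
  have hmeas := (stronglyMeasurable_betaPDFReal α β).aestronglyMeasurable (μ := volume)
  constructor
  · refine ⟨hmeas, ?_⟩
    rw [hasFiniteIntegral_iff_ofReal hnonneg, hmass]
    exact ENNReal.one_lt_top
  · rw [integral_eq_lintegral_of_nonneg_ae hnonneg hmeas, hmass, ENNReal.toReal_one]

open ProbabilityTheory in
/-- The weight of the Dunkl kernel is an affine image of a beta density. -/
lemma indicator_dunkl_weight_eq_betaPDFReal {κ : ℝ} (hκ : 0 < κ) :
    (Set.Ioo (-1 : ℝ) 1).indicator (fun u : ℝ => (1 + u) * (1 - u ^ 2) ^ (κ - 1)) =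
      fun u => (2 * 4 ^ (κ - 1) * beta (κ + 1) κ) * betaPDFReal (κ + 1) κ ((u + 1) / 2) := by
  funext u
  by_cases hu : u ∈ Set.Ioo (-1 : ℝ) 1
  · have h0 : 0 < (u + 1) / 2 := by linarith [hu.1]
    have h1 : (u + 1) / 2 < 1 := by linarith [hu.2]
    have hbeta := (beta_pos (show 0 < κ + 1 by linarith) hκ).ne'
    rw [Set.indicator_of_mem hu, betaPDFReal, if_pos ⟨h0, h1⟩]
    obtain ⟨x, rfl⟩ : ∃ x, u = 2 * x - 1 := ⟨(u + 1) / 2, by ring⟩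
    have hx : (2 * x - 1 + 1) / 2 = x := by ring
    rw [hx] at h0 h1 ⊢
    rw [show 1 - (2 * x - 1) ^ 2 = 4 * (x * (1 - x)) by ring,
      Real.mul_rpow (by norm_num) (by nlinarith), Real.mul_rpow h0.le (by linarith),
      show x ^ (κ + 1 - 1) = x * x ^ (κ - 1) by
        rw [add_sub_cancel_right, Real.rpow_sub_one h0.ne']; field_simp]
    field_simp
    ring
  · rw [Set.indicator_of_notMem hu, betaPDFReal, if_neg, mul_zero]
    rintro ⟨h0, h1⟩
    exact hu ⟨by linarith, by linarith⟩

lemma integrableOn_dunkl_weight {κ : ℝ} (hκ : 0 < κ) :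
    IntegrableOn (fun u : ℝ => (1 + u) * (1 - u ^ 2) ^ (κ - 1)) (Set.Ioo (-1 : ℝ) 1) := by
  rw [← integrable_indicator_iff measurableSet_Ioo, indicator_dunkl_weight_eq_betaPDFReal hκ]
  exact (((integrable_betaPDFReal_and_integral_eq_one (by linarith) hκ).1.comp_div
    two_ne_zero).comp_add_right 1).const_mul _

open ProbabilityTheory in
/-- The constant `bk κ` normalizes the weight of the Dunkl kernel. -/
lemma bk_mul_integral_dunkl_weight {κ : ℝ} (hκ : 0 < κ) :
    bk κ * ∫ u in Set.Ioo (-1 : ℝ) 1, (1 + u) * (1 - u ^ 2) ^ (κ - 1) = 1 := by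
  rw [← integral_indicator measurableSet_Ioo, indicator_dunkl_weight_eq_betaPDFReal hκ,
    integral_const_mul,
    integral_add_right_eq_self (fun u => betaPDFReal (κ + 1) κ (u / 2)) 1,
    Measure.integral_comp_div, (integrable_betaPDFReal_and_integral_eq_one (by linarith) hκ).2]
  have hΓ := Real.Gamma_pos_of_pos hκ
  have hΓ' := Real.Gamma_pos_of_pos (show 0 < 2 * κ by linarith)
  have hdup := Real.Gamma_mul_Gamma_add_half κ
  have hhalf : Real.Gamma (κ + 1 / 2) =
      Real.Gamma (2 * κ) * 2 ^ (1 - 2 * κ) * √π / Real.Gamma κ := by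
    rw [eq_div_iff hΓ.ne', mul_comm, hdup]
  have hpow : (2 : ℝ) ^ (1 - 2 * κ) * 4 ^ (κ - 1) = 1 / 2 := by
    rw [show (4 : ℝ) = 2 ^ (2 : ℝ) by norm_num, ← Real.rpow_mul (by norm_num),
      ← Real.rpow_add (by norm_num), show 1 - 2 * κ + 2 * (κ - 1) = -1 by ring,
      Real.rpow_neg_one, one_div]
  have hπ : 0 < √π := Real.sqrt_pos.2 Real.pi_pos
  rw [bk, hhalf, beta, Real.Gamma_add_one hκ.ne', show κ + 1 + κ = 2 * κ + 1 by ring,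
    Real.Gamma_add_one (by positivity)]
  simp only [abs_two, smul_eq_mul, mul_one]
  field_simp
  linear_combination 2 * hpow

lemma bk_pos {κ : ℝ} (hκ : 0 < κ) : 0 < bk κ :=
  div_pos (Real.Gamma_pos_of_pos (by linarith))
    (mul_pos (Real.sqrt_pos.2 Real.pi_pos) (Real.Gamma_pos_of_pos hκ))

lemma ck_nonneg (κ : ℝ) : 0 ≤ ck κ :=
  inv_nonneg.2 (integral_nonneg fun _ => (Real.exp_pos _).le)

instance (κ : ℝ) : SFinite (mu κ) := by
  unfold mu
  infer_instance

/-- Growth of the Dunkl kernel in the imaginary direction. -/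
lemma norm_Ek_le {κ : ℝ} (hκ : 0 < κ) (x : ℝ) (ζ : ℂ) :
    ‖Ek κ x (-Complex.I * ζ)‖ ≤ Real.exp (|x| * |ζ.im|) := by
  have hnorm : ‖∫ u in Set.Ioo (-1 : ℝ) 1, Complex.exp (x * (-Complex.I * ζ) * (u : ℂ)) *
      (((1 + u) * (1 - u ^ 2) ^ (κ - 1) : ℝ) : ℂ)‖ ≤
      ∫ u in Set.Ioo (-1 : ℝ) 1,
        Real.exp (|x| * |ζ.im|) * ((1 + u) * (1 - u ^ 2) ^ (κ - 1)) := by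
    refine norm_integral_le_of_norm_le ((integrableOn_dunkl_weight hκ).const_mul _) ?_
    filter_upwards [ae_restrict_mem measurableSet_Ioo] with u hu
    have hw : 0 ≤ (1 + u) * (1 - u ^ 2) ^ (κ - 1) :=
      mul_nonneg (by linarith [hu.1]) (Real.rpow_nonneg (by nlinarith [hu.1, hu.2]) _)
    rw [norm_mul, Complex.norm_real, Real.norm_of_nonneg hw, Complex.norm_exp]
    gcongr
    have hre : ((x : ℂ) * (-Complex.I * ζ) * (u : ℂ)).re = x * ζ.im * u := by simp
    rw [hre]
    calc x * ζ.im * u ≤ |x * ζ.im * u| := le_abs_self _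
      _ = |x| * |ζ.im| * |u| := by rw [abs_mul, abs_mul]
      _ ≤ |x| * |ζ.im| * 1 := by
        gcongr
        exact abs_le.2 ⟨hu.1.le, hu.2.le⟩
      _ = |x| * |ζ.im| := mul_one _
  rw [integral_const_mul] at hnorm
  rw [Ek, norm_mul, Complex.norm_real, Real.norm_of_nonneg (bk_pos hκ).le]
  calc _ ≤ bk κ * (Real.exp (|x| * |ζ.im|) *
        ∫ u in Set.Ioo (-1 : ℝ) 1, (1 + u) * (1 - u ^ 2) ^ (κ - 1)) :=
        mul_le_mul_of_nonneg_left hnorm (bk_pos hκ).le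
    _ = Real.exp (|x| * |ζ.im|) := by
        rw [mul_left_comm, bk_mul_integral_dunkl_weight hκ, mul_one]

section FourierLaplace

variable {α : Type*} [MeasurableSpace α] {ν : Measure α} {g : α → ℂ} {h : α → ℝ} {B : ℝ}

/-- A Fourier–Laplace integrand whose frequencies are bounded by `B` is dominated. -/
lemma norm_mul_cexp_le (hbd : ∀ᵐ a ∂ν, g a ≠ 0 → |h a| ≤ B) :
    ∀ᵐ a ∂ν, ∀ ζ : ℂ, ‖g a * Complex.exp (h a * (-Complex.I * ζ))‖ ≤
      ‖g a‖ * Real.exp (B * ‖ζ‖) := by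
  filter_upwards [hbd] with a ha ζ
  by_cases hg : g a = 0
  · simp [hg]
  rw [norm_mul, Complex.norm_exp]
  gcongr
  calc _ ≤ ‖(h a : ℂ) * (-Complex.I * ζ)‖ := Complex.re_le_norm _
    _ = |h a| * ‖ζ‖ := by simp
    _ ≤ B * ‖ζ‖ := by gcongr; exact ha hg

lemma integrable_mul_cexp (hg : Integrable g ν) (hh : Measurable h)
    (hbd : ∀ᵐ a ∂ν, g a ≠ 0 → |h a| ≤ B) (ζ : ℂ) :
    Integrable (fun a => g a * Complex.exp (h a * (-Complex.I * ζ))) ν := by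
  refine (hg.norm.mul_const (Real.exp (B * ‖ζ‖))).mono'
    (hg.aestronglyMeasurable.mul (by fun_prop)) ?_
  filter_upwards [norm_mul_cexp_le hbd] with a ha using ha ζ

/-- A Fourier–Laplace integral with bounded frequencies is entire. -/
lemma differentiable_integral_mul_cexp (hg : Integrable g ν) (hh : Measurable h)
    (hbd : ∀ᵐ a ∂ν, g a ≠ 0 → |h a| ≤ B) :
    Differentiable ℂ fun ζ : ℂ => ∫ a, g a * Complex.exp (h a * (-Complex.I * ζ)) ∂ν := by
  intro ζ₀
  have hmeas (ζ : ℂ) :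
      AEStronglyMeasurable (fun a => g a * Complex.exp (h a * (-Complex.I * ζ))) ν :=
    (integrable_mul_cexp hg hh hbd ζ).aestronglyMeasurable
  refine (hasDerivAt_integral_of_dominated_loc_of_deriv_le (Metric.ball_mem_nhds ζ₀ one_pos)
    (F' := fun ζ a => g a * Complex.exp (h a * (-Complex.I * ζ)) * (h a * -Complex.I))
    (bound := fun a => ‖g a‖ * Real.exp (|B| * (‖ζ₀‖ + 1)) * |B|)
    (.of_forall hmeas) (integrable_mul_cexp hg hh hbd ζ₀)
    ((hmeas ζ₀).mul (by fun_prop)) ?_ ((hg.norm.mul_const _).mul_const _) ?_).2.differentiableAt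
  · filter_upwards [hbd, norm_mul_cexp_le hbd] with a ha hexp ζ hζ
    by_cases hga : g a = 0
    · simp [hga]
    have hnorm : ‖ζ‖ ≤ ‖ζ₀‖ + 1 := by
      have := norm_sub_norm_le ζ ζ₀
      have := mem_ball_iff_norm.1 hζ
      linarith
    rw [norm_mul]
    refine mul_le_mul ((hexp ζ).trans ?_) ?_ (norm_nonneg _) (by positivity)
    · gcongr
      exact le_abs_self B
    · simpa using (ha hga).trans (le_abs_self B)
  · refine .of_forall fun a ζ _ => ?_
    have hlin : HasDerivAt (fun ζ : ℂ => (h a : ℂ) * (-Complex.I * ζ)) (h a * -Complex.I) ζ := by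
      simpa using ((hasDerivAt_id ζ).const_mul (-Complex.I)).const_mul (h a : ℂ)
    simpa only [mul_assoc] using hlin.cexp.const_mul (g a)

end FourierLaplace

lemma differentiable_integral_mul_Ek {κ : ℝ} (hκ : 0 < κ) {B : ℝ} {f : ℝ → ℂ}
    (hf : Integrable f (mu κ)) (hsupp : ∀ x : ℝ, B < |x| → f x = 0) :
    Differentiable ℂ fun ζ : ℂ => ∫ x, f x * Ek κ x (-Complex.I * ζ) ∂(mu κ) := by
  set ν := (mu κ).prod (volume.restrict (Set.Ioo (-1 : ℝ) 1))
  set g : ℝ × ℝ → ℂ := fun p => f p.1 * (((1 + p.2) * (1 - p.2 ^ 2) ^ (κ - 1) : ℝ) : ℂ)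
  have hg : Integrable g ν := hf.mul_prod (integrableOn_dunkl_weight hκ).ofReal
  have hh : Measurable fun p : ℝ × ℝ => p.1 * p.2 := by fun_prop
  have hbd : ∀ᵐ p ∂ν, g p ≠ 0 → |p.1 * p.2| ≤ B := by
    have hmem : ∀ᵐ p ∂ν, p.2 ∈ Set.Ioo (-1 : ℝ) 1 :=
      Measure.quasiMeasurePreserving_snd.ae (ae_restrict_mem measurableSet_Ioo)
    filter_upwards [hmem] with p hp hgp
    have hp1 : |p.1| ≤ B := not_lt.1 fun hlt => hgp (by simp [g, hsupp _ hlt])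
    rw [abs_mul]
    exact (mul_le_of_le_one_right (abs_nonneg _) (abs_le.2 ⟨hp.1.le, hp.2.le⟩)).trans hp1
  suffices heq : (fun ζ : ℂ => ∫ x, f x * Ek κ x (-Complex.I * ζ) ∂(mu κ)) = fun ζ =>
      (bk κ : ℂ) * ∫ p, g p * Complex.exp ((p.1 * p.2 : ℝ) * (-Complex.I * ζ)) ∂ν from
    heq ▸ (differentiable_integral_mul_cexp hg hh hbd).const_mul (bk κ : ℂ)
  funext ζ
  rw [integral_prod _ (integrable_mul_cexp hg hh hbd ζ), ← integral_const_mul]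
  refine integral_congr_ae (.of_forall fun x => ?_)
  simp only [Ek]
  rw [mul_left_comm, ← integral_const_mul]
  congr 1
  refine integral_congr_ae (.of_forall fun u => ?_)
  simp only [g]
  rw [show ((x * u : ℝ) : ℂ) * (-Complex.I * ζ) = x * (-Complex.I * ζ) * u by push_cast; ring]
  ring

/-- Paley–Wiener estimate (direct part). -/
theorem paley_wiener (κ : ℝ) (hκ : 0 < κ) (B : ℝ) (hB : 0 < B) (f : ℝ → ℂ)
    (hf : Integrable f (mu κ)) (hsupp : ∀ x : ℝ, B < |x| → f x = 0)
    (F : ℂ → ℂ)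
    (hF : F = fun ζ => (ck κ : ℂ) * ∫ x, f x * Ek κ (x : ℂ) (-Complex.I * ζ) ∂(mu κ)) :
    Differentiable ℂ F ∧ (∀ y : ℝ, F (y : ℂ) = dunkl κ f y) ∧
      ∀ ζ : ℂ, ‖F ζ‖ ≤ ck κ * (∫ x, ‖f x‖ ∂(mu κ)) * Real.exp (B * |ζ.im|) := by
  subst hF
  refine ⟨(differentiable_integral_mul_Ek hκ hf hsupp).const_mul _, fun _ => rfl, fun ζ => ?_⟩
  rw [norm_mul, Complex.norm_real, Real.norm_of_nonneg (ck_nonneg κ), mul_assoc,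
    ← integral_mul_const]
  refine mul_le_mul_of_nonneg_left ?_ (ck_nonneg κ)
  refine norm_integral_le_of_norm_le (hf.norm.mul_const _) (.of_forall fun x => ?_)
  by_cases hx : B < |x|
  · simp [hsupp x hx]
  rw [norm_mul]
  gcongr
  refine (norm_Ek_le hκ x ζ).trans ?_
  gcongr
  exact not_lt.1 hx
end

section
/- Support of the generalized translation: for every κ > 0, B > 0 and s ∈ ℝ, if f : ℝ → ℂ vanishes outside the interval [−B, B], then τ_s f(t) = 0 for every t with |t| > B + |s|. -/
open MeasureTheory Real Filter Topology

/-- The density `Φ_κ(u) = b_κ (1+u)(1-u²)^{κ-1}`. -/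
noncomputable def Phi (κ u : ℝ) : ℝ := bk κ * (1 + u) * (1 - u ^ 2) ^ (κ - 1)

/-- The generalized (Dunkl) translation operator `τ_s` for the group `ℤ₂` on `ℝ`. -/
noncomputable def tau (κ s : ℝ) (f : ℝ → ℂ) (t : ℝ) : ℂ :=
  (1 / 2 : ℂ) * ∫ u in Set.Ioo (-1 : ℝ) 1,
    (f (Real.sqrt (t ^ 2 + s ^ 2 - 2 * s * t * u)) *
        ((1 + (t - s) / Real.sqrt (t ^ 2 + s ^ 2 - 2 * s * t * u) : ℝ) : ℂ) +
      f (-Real.sqrt (t ^ 2 + s ^ 2 - 2 * s * t * u)) *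
        ((1 - (t - s) / Real.sqrt (t ^ 2 + s ^ 2 - 2 * s * t * u) : ℝ) : ℂ)) *
    ((Phi κ u : ℝ) : ℂ)

/-- The generalized triangle inequality `|t| - |s| ≤ √(t² + s² - 2stu)` for `|u| ≤ 1`. -/
lemma abs_sub_abs_le_sqrt (s t : ℝ) {u : ℝ} (hu : |u| ≤ 1) :
    |t| - |s| ≤ √(t ^ 2 + s ^ 2 - 2 * s * t * u) := by
  apply Real.le_sqrt_of_sq_le
  have h : s * t * u ≤ |s| * |t| :=
    calc s * t * u ≤ |s * t * u| := le_abs_self _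
      _ = |s| * |t| * |u| := by rw [abs_mul, abs_mul]
      _ ≤ |s| * |t| := mul_le_of_le_one_right (by positivity) hu
  nlinarith [sq_abs s, sq_abs t]

/-- support of the generalized translation: if `f` vanishes outside
`[-B,B]` then `τ_s f` vanishes outside `[-(B+|s|), B+|s|]`. -/
theorem translation_support (κ : ℝ) (hκ : 0 < κ) (B : ℝ) (hB : 0 < B) (s : ℝ)
    (f : ℝ → ℂ) (hsupp : ∀ x : ℝ, B < |x| → f x = 0) :
    ∀ t : ℝ, B + |s| < |t| → tau κ s f t = 0 := by
  intro t ht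
  unfold tau
  rw [setIntegral_eq_zero_of_forall_eq_zero, mul_zero]
  intro u hu
  have hR : B < √(t ^ 2 + s ^ 2 - 2 * s * t * u) :=
    (lt_sub_iff_add_lt.mpr ht).trans_le
      (abs_sub_abs_le_sqrt s t (abs_le.mpr ⟨hu.1.le, hu.2.le⟩))
  rw [hsupp _ (hR.trans_le (le_abs_self _)),
    hsupp (-_) (by rw [abs_neg]; exact hR.trans_le (le_abs_self _))]
  simp
end

section
/- Continuity of translation on compactly supported smooth functions: for every κ > 0 and B > 0, if f is a smooth, compactly supported function on ℝ with support contained in [−B, B], then there exists a constant C (depending only on κ and f) such that for every s ∈ ℝ and every p with 1 ≤ p ≤ ∞, ‖τ_s f − f‖_{L^p(μ_κ)} ≤ C |s| (B + |s|)^{(2κ+1)/p}. In particular ‖τ_s f − f‖_{L^p(μ_κ)} → 0 as s → 0. -/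
open MeasureTheory Real Filter Topology

/-- The normalizing constant of `Φ_κ` in terms of the beta function. -/
lemma bk_mul_four_rpow_mul_beta {κ : ℝ} (hκ : 0 < κ) :
    bk κ * 4 ^ κ * ProbabilityTheory.beta (κ + 1) κ = 1 := by
  have hdup := Real.Gamma_mul_Gamma_add_half κ
  have hG := Real.Gamma_pos_of_pos hκ
  have hG2 := Real.Gamma_pos_of_pos (by linarith : 0 < 2 * κ)
  have hpi : 0 < √π := Real.sqrt_pos.mpr Real.pi_pos
  have h4 : (4 : ℝ) ^ κ * 2 ^ (1 - 2 * κ) = 2 := by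
    rw [show (4 : ℝ) = 2 ^ (2 : ℝ) by norm_num, ← Real.rpow_mul (by norm_num),
      ← Real.rpow_add (by norm_num)]
    simp
  rw [bk, ProbabilityTheory.beta, Real.Gamma_add_one hκ.ne',
    show κ + 1 + κ = 2 * κ + 1 by ring, Real.Gamma_add_one (by positivity)]
  generalize Real.Gamma (κ + 1 / 2) = G at *
  generalize Real.Gamma (2 * κ) = D at *
  field_simp
  linear_combination (4 : ℝ) ^ κ * hdup + (D * √π) * h4

lemma Phi_nonneg {κ : ℝ} (hκ : 0 < κ) {u : ℝ} (hu : u ∈ Set.Ioo (-1 : ℝ) 1) : 0 ≤ Phi κ u := by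
  have h1 : 0 ≤ 1 - u ^ 2 := by nlinarith [hu.1, hu.2]
  have h2 : 0 ≤ 1 + u := by linarith [hu.1]
  have := Real.Gamma_pos_of_pos hκ
  have := Real.Gamma_pos_of_pos (by linarith : 0 < κ + 1 / 2)
  unfold Phi bk
  positivity

/-- The density `Φ_κ` is a rescaled beta density. -/
lemma indicator_Phi_eq_betaPDFReal {κ : ℝ} (hκ : 0 < κ) (u : ℝ) :
    (Set.Ioo (-1 : ℝ) 1).indicator (Phi κ) u =
      2⁻¹ * ProbabilityTheory.betaPDFReal (κ + 1) κ ((u + 1) / 2) := by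
  by_cases hu : u ∈ Set.Ioo (-1 : ℝ) 1
  · have h0 : 0 < (u + 1) / 2 := by linarith [hu.1]
    have h1 : (u + 1) / 2 < 1 := by linarith [hu.2]
    rw [Set.indicator_of_mem hu, ProbabilityTheory.betaPDFReal, if_pos ⟨h0, h1⟩]
    obtain ⟨v, rfl⟩ : ∃ v, u = 2 * v - 1 := ⟨(u + 1) / 2, by ring⟩
    rw [show (2 * v - 1 + 1) / 2 = v by ring] at *
    have hb := bk_mul_four_rpow_mul_beta hκ
    have hbeta := ProbabilityTheory.beta_pos (by linarith : 0 < κ + 1) hκ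
    have hv : v ^ κ = v ^ (κ - 1) * v := by
      rw [← Real.rpow_add_one h0.ne', sub_add_cancel]
    have h4 : (4 : ℝ) ^ κ = 4 ^ (κ - 1) * 4 := by
      rw [← Real.rpow_add_one (by norm_num), sub_add_cancel]
    rw [Phi, show 1 - (2 * v - 1) ^ 2 = 4 * v * (1 - v) by ring,
      Real.mul_rpow (by positivity) (by linarith), Real.mul_rpow (by norm_num) h0.le,
      add_sub_cancel_right, hv]
    rw [h4] at hb
    field_simp
    linear_combination v * (1 - v) ^ (κ - 1) * hb
  · rw [Set.indicator_of_notMem hu, ProbabilityTheory.betaPDFReal, if_neg, mul_zero]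
    exact fun h => hu ⟨by linarith [h.1], by linarith [h.2]⟩

lemma integral_Phi {κ : ℝ} (hκ : 0 < κ) : ∫ u in Set.Ioo (-1 : ℝ) 1, Phi κ u = 1 := by
  have hβ : ∫ x, ProbabilityTheory.betaPDFReal (κ + 1) κ x = 1 := by
    rw [integral_eq_lintegral_of_nonneg_ae _ (by fun_prop)]
    · exact (ENNReal.toReal_eq_one_iff _).mpr
        (ProbabilityTheory.lintegral_betaPDF_eq_one (by linarith) hκ)
    · refine Eventually.of_forall fun x => ?_
      by_cases hx : 0 < x ∧ x < 1
      · exact (ProbabilityTheory.betaPDFReal_pos hx.1 hx.2 (by linarith) hκ).le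
      · simp [ProbabilityTheory.betaPDFReal, hx]
  rw [← integral_indicator measurableSet_Ioo]
  simp_rw [indicator_Phi_eq_betaPDFReal hκ]
  rw [integral_const_mul,
    integral_add_right_eq_self (fun u => ProbabilityTheory.betaPDFReal (κ + 1) κ (u / 2)),
    Measure.integral_comp_div, hβ]
  norm_num

lemma integrableOn_Phi {κ : ℝ} (hκ : 0 < κ) : IntegrableOn (Phi κ) (Set.Ioo (-1 : ℝ) 1) := by
  by_contra h
  exact zero_ne_one ((integral_undef h).symm.trans (integral_Phi hκ))

/-- The distance `√(t² + s² - 2stu)` lies between `||t| - |s||` and `|t| + |s|`. -/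
lemma abs_sqrt_sub_abs_le {s t u : ℝ} (hu : u ∈ Set.Ioo (-1 : ℝ) 1) :
    |(√(t ^ 2 + s ^ 2 - 2 * s * t * u) - |t|)| ≤ |s| := by
  have hstu : |s * t * u| ≤ |s| * |t| := by
    rw [abs_mul, abs_mul]
    exact mul_le_of_le_one_right (by positivity) (abs_le.mpr ⟨hu.1.le, hu.2.le⟩)
  obtain ⟨h1, h2⟩ := abs_le.mp hstu
  have ht := sq_abs t
  have hs := sq_abs s
  rw [abs_le]
  constructor
  · have := Real.abs_le_sqrt
      (show (|t| - |s|) ^ 2 ≤ t ^ 2 + s ^ 2 - 2 * s * t * u by nlinarith)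
    linarith [le_abs_self (|t| - |s|)]
  · have : √(t ^ 2 + s ^ 2 - 2 * s * t * u) ≤ |t| + |s| :=
      Real.sqrt_le_iff.mpr ⟨by positivity, by nlinarith⟩
    linarith

/-- Lipschitz estimate for the two-point average entering the generalized translation. -/
lemma norm_twoPoint_sub_le {f : ℝ → ℂ} {K : NNReal} (hf : LipschitzWith K f) {r s t : ℝ}
    (hr : 0 ≤ r) (hrt : |(r - |t|)| ≤ |s|) :
    ‖f r * ((1 + (t - s) / r : ℝ) : ℂ) + f (-r) * ((1 - (t - s) / r : ℝ) : ℂ) - 2 * f t‖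
      ≤ 6 * K * |s| := by
  have hdist (x y : ℝ) : ‖f x - f y‖ ≤ K * |x - y| := by
    simpa [dist_eq_norm] using hf.dist_le_mul x y
  have key (a d : ℝ) (ha : |a - t| ≤ |s|) (hd : |d| * r ≤ 2 * |s|) :
      ‖2 * (f a - f t) + (d : ℂ) * (f r - f (-r))‖ ≤ 6 * K * |s| := by
    have h1 : ‖f a - f t‖ ≤ K * |s| := (hdist a t).trans (by gcongr)
    have h2 : ‖f r - f (-r)‖ ≤ K * (2 * r) := by
      simpa [← two_mul, abs_of_nonneg hr] using hdist r (-r)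
    calc _ ≤ ‖2 * (f a - f t)‖ + ‖(d : ℂ) * (f r - f (-r))‖ := norm_add_le _ _
      _ = 2 * ‖f a - f t‖ + |d| * ‖f r - f (-r)‖ := by simp
      _ ≤ 2 * (K * |s|) + |d| * (K * (2 * r)) := by gcongr
      _ = 2 * (K * |s|) + 2 * K * (|d| * r) := by ring
      _ ≤ 2 * (K * |s|) + 2 * K * (2 * |s|) := by gcongr
      _ = 6 * K * |s| := by ring
  have hmul (ε : ℝ) (h : |t - s + ε * r| ≤ 2 * |s|) : |(t - s) / r + ε| * r ≤ 2 * |s| := by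
    rcases hr.eq_or_lt with rfl | hr'
    · simp
    · rwa [← abs_of_pos hr', ← abs_mul, abs_of_pos hr', add_mul, div_mul_cancel₀ _ hr'.ne']
  obtain ⟨h1, h2⟩ := abs_le.mp hrt
  have h3 := neg_abs_le s
  have h4 := le_abs_self s
  rcases le_total 0 t with ht | ht
  · rw [abs_of_nonneg ht] at *
    convert key r ((t - s) / r + -1) hrt (hmul _ (abs_le.mpr ⟨by linarith, by linarith⟩)) using 2
    push_cast
    ring
  · rw [abs_of_nonpos ht] at *
    convert key (-r) ((t - s) / r + 1) (abs_le.mpr ⟨by linarith, by linarith⟩)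
      (hmul _ (abs_le.mpr ⟨by linarith, by linarith⟩)) using 2
    push_cast
    ring

/-- Uniform estimate for `τ_s f - f` when `f` is Lipschitz. -/
lemma norm_tau_sub_le {κ : ℝ} (hκ : 0 < κ) {f : ℝ → ℂ} {K : NNReal} (hf : LipschitzWith K f)
    (s t : ℝ) : ‖tau κ s f t - f t‖ ≤ 3 * K * |s| := by
  set F : ℝ → ℂ := fun u =>
    f (√(t ^ 2 + s ^ 2 - 2 * s * t * u)) *
        ((1 + (t - s) / √(t ^ 2 + s ^ 2 - 2 * s * t * u) : ℝ) : ℂ) +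
      f (-√(t ^ 2 + s ^ 2 - 2 * s * t * u)) *
        ((1 - (t - s) / √(t ^ 2 + s ^ 2 - 2 * s * t * u) : ℝ) : ℂ)
  have hΦ : IntegrableOn (fun u => (Phi κ u : ℂ)) (Set.Ioo (-1 : ℝ) 1) :=
    (integrableOn_Phi hκ).ofReal
  have hbound : ∀ u ∈ Set.Ioo (-1 : ℝ) 1, ‖F u - 2 * f t‖ ≤ 6 * K * |s| := fun u hu =>
    norm_twoPoint_sub_le hf (Real.sqrt_nonneg _) (abs_sqrt_sub_abs_le hu)
  have hmeas : Measurable F := by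
    have := hf.continuous.measurable
    fun_prop
  have hint : IntegrableOn (fun u => (F u - 2 * f t) * (Phi κ u : ℂ)) (Set.Ioo (-1 : ℝ) 1) :=
    hΦ.bdd_mul (hmeas.sub_const _).aestronglyMeasurable
      (ae_restrict_of_forall_mem measurableSet_Ioo hbound)
  have hone : ∫ u in Set.Ioo (-1 : ℝ) 1, (Phi κ u : ℂ) = 1 := by
    rw [integral_complex_ofReal, integral_Phi hκ, Complex.ofReal_one]
  have heq : tau κ s f t - f t =
      (1 / 2 : ℂ) * ∫ u in Set.Ioo (-1 : ℝ) 1, (F u - 2 * f t) * (Phi κ u : ℂ) := by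
    have hsplit : ∫ u in Set.Ioo (-1 : ℝ) 1, F u * (Phi κ u : ℂ) =
        (∫ u in Set.Ioo (-1 : ℝ) 1, (F u - 2 * f t) * (Phi κ u : ℂ)) + 2 * f t := by
      have hconst : ∫ u in Set.Ioo (-1 : ℝ) 1, 2 * f t * (Phi κ u : ℂ) = 2 * f t := by
        rw [integral_const_mul, hone, mul_one]
      refine Eq.trans ?_ ((integral_add hint (hΦ.const_mul (2 * f t))).trans (by rw [hconst]))
      congr 1 with u
      ring
    rw [tau, hsplit]
    ring
  have hle : ‖∫ u in Set.Ioo (-1 : ℝ) 1, (F u - 2 * f t) * (Phi κ u : ℂ)‖ ≤ 6 * K * |s| := by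
    calc _ ≤ ∫ u in Set.Ioo (-1 : ℝ) 1, 6 * K * |s| * Phi κ u := by
          refine norm_integral_le_of_norm_le ((integrableOn_Phi hκ).const_mul _)
            (ae_restrict_of_forall_mem measurableSet_Ioo fun u hu => ?_)
          rw [norm_mul, Complex.norm_real, Real.norm_of_nonneg (Phi_nonneg hκ hu)]
          exact mul_le_mul_of_nonneg_right (hbound u hu) (Phi_nonneg hκ hu)
      _ = 6 * K * |s| := by rw [integral_const_mul, integral_Phi hκ, mul_one]
  rw [heq, norm_mul]
  norm_num
  linarith

lemma tau_eq_zero_of_lt_abs {κ B s t : ℝ} {f : ℝ → ℂ} (hsupp : ∀ x : ℝ, B < |x| → f x = 0)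
    (ht : B + |s| < |t|) : tau κ s f t = 0 := by
  rw [tau, setIntegral_eq_zero_of_forall_eq_zero, mul_zero]
  intro u hu
  have hr : B < √(t ^ 2 + s ^ 2 - 2 * s * t * u) := by
    linarith [neg_le_of_abs_le (abs_sqrt_sub_abs_le (s := s) (t := t) hu)]
  have hr' := lt_of_lt_of_le hr (le_abs_self _)
  rw [hsupp _ hr', hsupp _ (by rwa [abs_neg])]
  simp

lemma mu_Icc_le {κ : ℝ} (hκ : 0 < κ) {R : ℝ} (hR : 0 < R) :
    mu κ (Set.Icc (-R) R) ≤ ENNReal.ofReal (2 * R ^ (2 * κ + 1)) := by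
  rw [mu, withDensity_apply _ measurableSet_Icc]
  calc ∫⁻ t in Set.Icc (-R) R, ENNReal.ofReal (|t| ^ (2 * κ))
      ≤ ∫⁻ _ in Set.Icc (-R) R, ENNReal.ofReal (R ^ (2 * κ)) := by
        refine setLIntegral_mono (by fun_prop) fun t ht => ENNReal.ofReal_le_ofReal ?_
        exact Real.rpow_le_rpow (abs_nonneg t) (abs_le.mpr ht) (by positivity)
    _ = ENNReal.ofReal (2 * R ^ (2 * κ + 1)) := by
        rw [setLIntegral_const, Real.volume_Icc, ← ENNReal.ofReal_mul (by positivity),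
          Real.rpow_add_one hR.ne']
        congr 1
        ring

lemma eLpNorm_tau_sub_le {κ : ℝ} (hκ : 0 < κ) {B : ℝ} (hB : 0 < B) {f : ℝ → ℂ} {K : NNReal}
    (hf : LipschitzWith K f) (hsupp : ∀ x : ℝ, B < |x| → f x = 0) (s : ℝ) {p : ENNReal}
    (hp : 1 ≤ p) :
    eLpNorm (fun t => tau κ s f t - f t) p (mu κ) ≤
      ENNReal.ofReal (6 * K * |s| * (B + |s|) ^ ((2 * κ + 1) / p.toReal)) := by
  have hR : 0 < B + |s| := by positivity
  have hinv : p.toReal⁻¹ ≤ 1 := by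
    rcases eq_or_ne p ⊤ with rfl | hp'
    · simp
    · exact inv_le_one_of_one_le₀ 
        ((ENNReal.ofReal_le_iff_le_toReal hp').mp (by simpa using hp))
  have hsub : Function.support (fun t => tau κ s f t - f t) ⊆
      Set.Icc (-(B + |s|)) (B + |s|) := by
    intro t ht
    by_contra hmem
    have hlt : B + |s| < |t| := by
      by_contra! h
      exact hmem (abs_le.mp h)
    refine ht ?_
    simp only [tau_eq_zero_of_lt_abs hsupp hlt, zero_sub, neg_eq_zero]
    exact hsupp t (by linarith [abs_nonneg s])
  rw [← eLpNorm_restrict_eq_of_support_subset hsub]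
  calc eLpNorm _ p ((mu κ).restrict (Set.Icc (-(B + |s|)) (B + |s|)))
      ≤ ((mu κ).restrict (Set.Icc (-(B + |s|)) (B + |s|))) Set.univ ^ p.toReal⁻¹ *
          ENNReal.ofReal (3 * K * |s|) :=
        eLpNorm_le_of_ae_bound (Eventually.of_forall fun t => norm_tau_sub_le hκ hf s t)
    _ ≤ ENNReal.ofReal (2 * (B + |s|) ^ (2 * κ + 1)) ^ p.toReal⁻¹ *
          ENNReal.ofReal (3 * K * |s|) := by
        rw [Measure.restrict_apply_univ]
        gcongr
        exact mu_Icc_le hκ hR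
    _ = ENNReal.ofReal
          ((2 * (B + |s|) ^ (2 * κ + 1)) ^ p.toReal⁻¹ * (3 * K * |s|)) := by
        rw [ENNReal.ofReal_rpow_of_nonneg (by positivity) (by positivity),
          ← ENNReal.ofReal_mul (by positivity)]
    _ ≤ ENNReal.ofReal (6 * K * |s| * (B + |s|) ^ ((2 * κ + 1) / p.toReal)) := by
        refine ENNReal.ofReal_le_ofReal ?_
        rw [Real.mul_rpow (by norm_num) (by positivity), ← Real.rpow_mul hR.le, ← div_eq_mul_inv]
        have h2 : (2 : ℝ) ^ p.toReal⁻¹ ≤ 2 := by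
          simpa using Real.rpow_le_rpow_of_exponent_le (by norm_num : (1 : ℝ) ≤ 2) hinv
        calc _ ≤ 2 * (B + |s|) ^ ((2 * κ + 1) / p.toReal) * (3 * K * |s|) := by gcongr
          _ = _ := by ring

/-- continuity of translation on compactly supported smooth functions:
`‖τ_s f - f‖_{L^p(μ_κ)} ≤ C |s| (B+|s|)^{(2κ+1)/p}`, and hence `τ_s f → f` in
`L^p(μ_κ)` as `s → 0`.  (For `p = ∞` the exponent `(2κ+1)/p` is read as `0`.) -/
theorem translation_continuity (κ : ℝ) (hκ : 0 < κ) (B : ℝ) (hB : 0 < B)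
    (f : ℝ → ℂ) (hsmooth : ContDiff ℝ (⊤ : ℕ∞) f) (hsupp : ∀ x : ℝ, B < |x| → f x = 0) :
    ∃ C : ℝ, (∀ s : ℝ, ∀ p : ENNReal, 1 ≤ p →
      eLpNorm (fun t => tau κ s f t - f t) p (mu κ) ≤
        ENNReal.ofReal (C * |s| * (B + |s|) ^ ((2 * κ + 1) / p.toReal))) ∧
      ∀ p : ENNReal, 1 ≤ p →
        Tendsto (fun s : ℝ => eLpNorm (fun t => tau κ s f t - f t) p (mu κ))
          (nhds 0) (nhds 0) := by
  have hcomp : HasCompactSupport f := by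
    refine HasCompactSupport.of_support_subset_isCompact (isCompact_Icc (a := -B) (b := B)) ?_
    intro x hx
    by_contra hmem
    exact hx (hsupp x (not_le.mp fun h => hmem (abs_le.mp h)))
  obtain ⟨K, hK⟩ := ContDiff.lipschitzWith_of_hasCompactSupport hcomp hsmooth (by simp)
  refine ⟨6 * K, fun s p hp => eLpNorm_tau_sub_le hκ hB hK hsupp s hp, fun p hp => ?_⟩
  refine tendsto_of_tendsto_of_tendsto_of_le_of_le tendsto_const_nhds ?_
    (fun s => zero_le) (fun s => eLpNorm_tau_sub_le hκ hB hK hsupp s hp)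
  have hcont : Continuous fun s : ℝ =>
      ENNReal.ofReal (6 * K * |s| * (B + |s|) ^ ((2 * κ + 1) / p.toReal)) := by
    refine ENNReal.continuous_ofReal.comp ((by fun_prop : Continuous _).mul ?_)
    exact Continuous.rpow_const (by fun_prop) fun s => Or.inl (by positivity)
  simpa using hcont.tendsto 0
end
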